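/- arXiv:2003.10189 — 2 statements merged into one kernel-verified Lean document; each statement's English description precedes it below -/
import Mathlib

section
/- (Gradient bound) For every M > 0 and δ > 0 there exists a constant K > 0, depending only on V, M and δ, such that for every bounded smooth domain Ω ⊂ ℝ², every ε with 0 < ε ≤ δ/2 and ε ≤ 1, and every solution u_ε of the vectorial Allen–Cahn system on Ω with E_ε(u_ε,Ω) ≤ M, one has |∇u_ε(x)| ≤ K/ε for every x ∈ Ω with dist(x,∂Ω) ≥ δ. -/
open MeasureTheory Metric Filter Topology Bornology
open scoped RealInnerProductSpace ENNReal Topology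

noncomputable section

/-- The euclidean plane. -/
abbrev E2 : Type := EuclideanSpace ℝ (Fin 2)

/-- The euclidean space `ℝ^k`. -/
abbrev Evec (k : ℕ) : Type := EuclideanSpace ℝ (Fin k)

/-- The `i`-th standard basis vector of the plane. -/
def b2 (i : Fin 2) : E2 := EuclideanSpace.single i (1 : ℝ)

/-- The partial derivative of `u` in the `i`-th coordinate direction. -/
def pder {k : ℕ} (u : E2 → Evec k) (i : Fin 2) (x : E2) : Evec k :=
  fderiv ℝ u x (b2 i)

/-- The Laplacian of a map defined on the plane. -/
def lap {k : ℕ} (u : E2 → Evec k) (x : E2) : Evec k :=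
  ∑ i : Fin 2, fderiv ℝ (pder u i) x (b2 i)

/-- `u` is a smooth solution of the vectorial Allen-Cahn system
`Δu = ε⁻² ∇V(u)` on the open set `U`. -/
def IsSolution {k : ℕ} (V : Evec k → ℝ) (ε : ℝ) (U : Set E2) (u : E2 → Evec k) : Prop :=
  ContDiffOn ℝ (⊤ : ℕ∞) u U ∧ ∀ x ∈ U, lap u x = (ε ^ 2)⁻¹ • gradient V (u x)

/-- The squared modulus `|∇u|²` of the full gradient. -/
def gradSq {k : ℕ} (u : E2 → Evec k) (x : E2) : ℝ :=
  ∑ i : Fin 2, ‖pder u i x‖ ^ 2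

/-- The energy density `e_ε(u) = (ε/2)|∇u|² + ε⁻¹ V(u)`. -/
def eDens {k : ℕ} (V : Evec k → ℝ) (ε : ℝ) (u : E2 → Evec k) (x : E2) : ℝ :=
  ε / 2 * gradSq u x + ε⁻¹ * V (u x)

/-- The energy `E_ε(u, G)`. -/
def energy {k : ℕ} (V : Evec k → ℝ) (ε : ℝ) (u : E2 → Evec k) (G : Set E2) : ℝ :=
  ∫ x in G, eDens V ε u x

/-- The hypotheses (H₁), (H₂), (H₃) on the multi-well potential `V`:
smooth, nonnegative with `inf V = 0`, finitely many zeros (at least two),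
positive definite Hessian at each zero, quadratic growth of `y·∇V(y)` at
infinity and coercivity. -/
structure IsMultiWell {k : ℕ} (V : Evec k → ℝ) : Prop where
  smooth : ContDiff ℝ (⊤ : ℕ∞) V
  nonneg : ∀ y, 0 ≤ V y
  finite_zeros : {y : Evec k | V y = 0}.Finite
  two_le_card : 2 ≤ {y : Evec k | V y = 0}.ncard
  hess_posdef : ∀ σ : Evec k, V σ = 0 → ∀ w : Evec k, w ≠ 0 →
    0 < iteratedFDeriv ℝ 2 V σ ![w, w]
  growth : ∃ α > (0 : ℝ), ∃ R > (0 : ℝ), ∀ y : Evec k, R < ‖y‖ →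
    α * ‖y‖ ^ 2 ≤ ⟪y, gradient V y⟫
  coercive : ∀ C : ℝ, ∃ R : ℝ, ∀ y : Evec k, R ≤ ‖y‖ → C ≤ V y

/-- Second derivative test along a line at a local maximum. -/
lemma lineDeriv_lineDeriv_nonpos_of_isLocalMax {f f₁ : E2 → ℝ} {c : ℝ} {y v : E2}
    (hmax : IsLocalMax f y) (h1 : ∀ᶠ z in 𝓝 y, HasLineDerivAt ℝ f (f₁ z) z v)
    (h2 : HasLineDerivAt ℝ f₁ c y v) : c ≤ 0 := by
  have hline : Tendsto (fun t : ℝ => y + t • v) (𝓝 0) (𝓝 y) := by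
    have : Continuous (fun t : ℝ => y + t • v) := by fun_prop
    simpa using this.tendsto 0
  have hg : ∀ᶠ t in 𝓝 (0 : ℝ),
      HasDerivAt (fun t : ℝ => f (y + t • v)) (f₁ (y + t • v)) t := by
    filter_upwards [hline.eventually h1] with t ht
    have ht' : HasDerivAt (fun s : ℝ => f (y + t • v + s • v)) (f₁ (y + t • v)) (t - t) := by
      rw [sub_self]
      exact ht
    have := ht'.comp_sub_const t t
    refine this.congr_of_eventuallyEq (Eventually.of_forall fun s => ?_)
    simp only
    congr 1
    module
  have hd : deriv (fun t : ℝ => f (y + t • v)) =ᶠ[𝓝 0] fun t => f₁ (y + t • v) :=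
    hg.mono fun t ht => ht.deriv
  have hdd : deriv (deriv (fun t : ℝ => f (y + t • v))) 0 = c := by
    rw [hd.deriv_eq]
    exact HasDerivAt.deriv h2
  have hloc : IsLocalMax (fun t : ℝ => f (y + t • v)) 0 := by
    have : ∀ᶠ t in 𝓝 (0 : ℝ), f (y + t • v) ≤ f y := hline.eventually hmax
    simpa [IsLocalMax, IsMaxFilter] using this
  by_contra! hc
  have hmin := isLocalMin_of_deriv_deriv_pos (f := fun t : ℝ => f (y + t • v)) (x₀ := 0)
    (by rw [hdd]; exact hc) hloc.deriv_eq_zero hg.self_of_nhds.continuousAt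
  have hconst : (fun t : ℝ => f (y + t • v)) =ᶠ[𝓝 0] fun _ => f (y + (0 : ℝ) • v) := by
    filter_upwards [hloc, hmin] with t h h' using le_antisymm h h'
  have h0 := hconst.deriv.deriv_eq
  rw [hdd] at h0
  simp at h0
  exact hc.ne' h0

lemma contDiffAt_pder {k : ℕ} {u : E2 → Evec k} {y : E2} (hu : ContDiffAt ℝ (⊤ : ℕ∞) u y)
    (i : Fin 2) : ContDiffAt ℝ (⊤ : ℕ∞) (pder u i) y :=
  (hu.fderiv_right (m := (⊤ : ℕ∞)) (by simp)).clm_apply contDiffAt_const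

lemma hasLineDerivAt_pder {k : ℕ} {u : E2 → Evec k} {y : E2}
    (hu : ContDiffAt ℝ (⊤ : ℕ∞) u y) (i : Fin 2) : HasLineDerivAt ℝ u (pder u i y) y (b2 i) :=
  (hu.differentiableAt (by simp)).hasFDerivAt.hasLineDerivAt _

lemma eventually_contDiffAt {k : ℕ} {u : E2 → Evec k} {y : E2}
    {U : Set E2} (hU : U ∈ 𝓝 y)
    (huU : ContDiffOn ℝ (⊤ : ℕ∞) u U) : ∀ᶠ z in 𝓝 y, ContDiffAt ℝ (⊤ : ℕ∞) u z := by
  filter_upwards [eventually_mem_nhds_iff.2 hU] with z hz using huU.contDiffAt hz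

lemma pder_pder_comm {k : ℕ} {u : E2 → Evec k} {y : E2}
    (hu : ContDiffAt ℝ (⊤ : ℕ∞) u y) (i j : Fin 2) :
    pder (pder u i) j y = pder (pder u j) i y := by
  have hs : IsSymmSndFDerivAt ℝ u y := hu.isSymmSndFDerivAt (by
    rw [minSmoothness_of_isRCLikeNormedField]
    exact WithTop.coe_le_coe.2 (le_top : (2 : ℕ∞) ≤ ⊤))
  have hd : DifferentiableAt ℝ (fderiv ℝ u) y :=
    (hu.fderiv_right (m := (⊤ : ℕ∞)) (by simp)).differentiableAt (by simp)
  have key : ∀ i j : Fin 2, pder (pder u i) j y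
      = fderiv ℝ (fderiv ℝ u) y (b2 j) (b2 i) := by
    intro i j
    have : HasFDerivAt (pder u i) _ y := hd.hasFDerivAt.clm_apply (hasFDerivAt_const (b2 i) y)
    unfold pder at this ⊢
    rw [this.fderiv]
    simp
  rw [key, key, hs]

lemma hasLineDerivAt_inner {k : ℕ} {f g : E2 → Evec k} {f' g' : Evec k} {z v : E2}
    (hf : HasLineDerivAt ℝ f f' z v) (hg : HasLineDerivAt ℝ g g' z v) :
    HasLineDerivAt ℝ (fun z => ⟪f z, g z⟫) (⟪f z, g'⟫ + ⟪f', g z⟫) z v := by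
  have := HasDerivAt.inner ℝ hf hg
  simpa [HasLineDerivAt] using this

lemma hasLineDerivAt_norm_sq {k : ℕ} {f : E2 → Evec k} {f' : Evec k} {z v : E2}
    (hf : HasLineDerivAt ℝ f f' z v) :
    HasLineDerivAt ℝ (fun z => ‖f z‖ ^ 2) (2 * ⟪f z, f'⟫) z v := by
  have := hasLineDerivAt_inner hf hf
  simp only [real_inner_self_eq_norm_sq, real_inner_comm (f z) f'] at this
  rw [two_mul]
  exact this

lemma hasLineDerivAt_mul {f g : E2 → ℝ} {f' g' : ℝ} {z v : E2}
    (hf : HasLineDerivAt ℝ f f' z v) (hg : HasLineDerivAt ℝ g g' z v) :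
    HasLineDerivAt ℝ (fun z => f z * g z) (f' * g z + f z * g') z v := by
  have := HasDerivAt.mul hf hg
  simp only [zero_smul, add_zero] at this
  exact this

lemma hasLineDerivAt_sub_apply (x z : E2) (j : Fin 2) :
    HasLineDerivAt ℝ (fun z : E2 => z j - x j) 1 z (b2 j) := by
  have : HasDerivAt (fun t : ℝ => z j + t * 1 - x j) 1 0 := by
    simpa using ((hasDerivAt_id (0 : ℝ)).const_add (z j)).sub_const (x j)
  simpa [HasLineDerivAt, b2] using this

lemma hasLineDerivAt_norm_sub_sq (x z : E2) (j : Fin 2) :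
    HasLineDerivAt ℝ (fun z : E2 => ‖z - x‖ ^ 2) (2 * (z j - x j)) z (b2 j) := by
  have h : HasLineDerivAt ℝ (fun z : E2 => z - x) (b2 j) z (b2 j) := by
    have := ((hasFDerivAt_id (𝕜 := ℝ) z).sub_const x).hasLineDerivAt (b2 j)
    simpa using this
  convert hasLineDerivAt_norm_sq h using 2
  simp [b2, EuclideanSpace.inner_single_right]

lemma gradSq_add_inner_lap_le {k : ℕ} {u : E2 → Evec k} {U : Set E2} {x y : E2} {A : ℝ}
    (hu : ContDiffOn ℝ (⊤ : ℕ∞) u U) (hU : U ∈ 𝓝 y)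
    (hmax : IsLocalMax (fun z => ‖u z‖ ^ 2 - A * ‖z - x‖ ^ 2) y) :
    gradSq u y + ⟪u y, lap u y⟫ ≤ 2 * A := by
  have hy : ContDiffAt ℝ (⊤ : ℕ∞) u y := hu.contDiffAt hU
  have key : ∀ j : Fin 2, 2 * (‖pder u j y‖ ^ 2 + ⟪u y, pder (pder u j) j y⟫) - 2 * A ≤ 0 := by
    intro j
    refine lineDeriv_lineDeriv_nonpos_of_isLocalMax (v := b2 j)
      (f₁ := fun z => 2 * ⟪u z, pder u j z⟫ - A * (2 * (z j - x j))) hmax ?_ ?_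
    · filter_upwards [eventually_contDiffAt hU hu] with z hz
      exact HasDerivAt.sub (hasLineDerivAt_norm_sq (hasLineDerivAt_pder hz j))
        (HasDerivAt.const_mul A (hasLineDerivAt_norm_sub_sq x z j))
    · have h1 := hasLineDerivAt_inner (hasLineDerivAt_pder hy j)
        (hasLineDerivAt_pder (contDiffAt_pder hy j) j)
      have h2 := hasLineDerivAt_sub_apply x y j
      have := HasDerivAt.sub (HasDerivAt.const_mul 2 h1)
        (HasDerivAt.const_mul A (HasDerivAt.const_mul 2 h2))
      refine HasDerivAt.congr_deriv this ?_
      rw [real_inner_self_eq_norm_sq]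
      ring
  have h0 := key 0
  have h1 := key 1
  have e : lap u y = pder (pder u 0) 0 y + pder (pder u 1) 1 y := by
    simp [lap, Fin.sum_univ_two, pder]
  have e2 : gradSq u y = ‖pder u 0 y‖ ^ 2 + ‖pder u 1 y‖ ^ 2 := by
    simp [gradSq, Fin.sum_univ_two]
  rw [e, e2, inner_add_right]
  linarith

lemma pder_lap {k : ℕ} {u : E2 → Evec k} {U : Set E2} {y : E2}
    (hu : ContDiffOn ℝ (⊤ : ℕ∞) u U) (hU : U ∈ 𝓝 y) (i : Fin 2) :
    pder (lap u) i y
      = pder (pder (pder u i) 0) 0 y + pder (pder (pder u i) 1) 1 y := by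
  have hy : ContDiffAt ℝ (⊤ : ℕ∞) u y := hu.contDiffAt hU
  have e : lap u = fun z => pder (pder u 0) 0 z + pder (pder u 1) 1 z := by
    ext1 z
    simp [lap, Fin.sum_univ_two, pder]
  have hd : ∀ j, DifferentiableAt ℝ (pder (pder u j) j) y := fun j =>
    (contDiffAt_pder (contDiffAt_pder hy j) j).differentiableAt (by simp)
  have hj : ∀ j, pder (pder (pder u i) j) j y = pder (pder (pder u j) j) i y := by
    intro j
    have h : pder (pder u i) j =ᶠ[𝓝 y] pder (pder u j) i := by
      filter_upwards [eventually_contDiffAt hU hu] with z hz using pder_pder_comm hz i j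
    calc pder (pder (pder u i) j) j y = pder (pder (pder u j) i) j y := by
          simp only [pder] at h ⊢
          rw [h.fderiv_eq]
      _ = _ := pder_pder_comm (contDiffAt_pder hy j) i j
  rw [hj, hj, e]
  change fderiv ℝ (fun z => pder (pder u 0) 0 z + pder (pder u 1) 1 z) y (b2 i) = _
  rw [fderiv_fun_add (hd 0) (hd 1)]
  rfl

lemma bernstein_le_of_isLocalMax {k : ℕ} {u : E2 → Evec k} {U : Set E2} {x y : E2} {ρ B : ℝ}
    (hu : ContDiffOn ℝ (⊤ : ℕ∞) u U) (hU : U ∈ 𝓝 y) (hyx : ‖y - x‖ ^ 2 ≤ ρ ^ 2)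
    (hmax : IsLocalMax (fun z => (ρ ^ 2 - ‖z - x‖ ^ 2) * (ρ ^ 2 - ‖z - x‖ ^ 2) * gradSq u z
      + B * ‖u z‖ ^ 2) y) :
    2 * (ρ ^ 2 - ‖y - x‖ ^ 2) ^ 2 * (∑ i : Fin 2, ⟪pder u i y, pder (lap u) i y⟫)
      + 2 * B * (gradSq u y + ⟪u y, lap u y⟫) ≤ 24 * ρ ^ 2 * gradSq u y := by
  have hy : ContDiffAt ℝ (⊤ : ℕ∞) u y := hu.contDiffAt hU
  set η : E2 → ℝ := fun z => ρ ^ 2 - ‖z - x‖ ^ 2 with hη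
  have hηd : ∀ z j, HasLineDerivAt ℝ η (-(2 * (z j - x j))) z (b2 j) := fun z j =>
    HasDerivAt.const_sub (ρ ^ 2) (hasLineDerivAt_norm_sub_sq x z j)
  have eG : gradSq u = fun z => ‖pder u 0 z‖ ^ 2 + ‖pder u 1 z‖ ^ 2 := by
    ext1 z
    simp [gradSq, Fin.sum_univ_two]
  let G1 : Fin 2 → E2 → ℝ := fun j z => 2 * ⟪pder u 0 z, pder (pder u 0) j z⟫
    + 2 * ⟪pder u 1 z, pder (pder u 1) j z⟫
  have hGd : ∀ z, ContDiffAt ℝ (⊤ : ℕ∞) u z → ∀ j,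
      HasLineDerivAt ℝ (gradSq u) (G1 j z) z (b2 j) := by
    intro z hz j
    rw [eG]
    exact HasDerivAt.add (hasLineDerivAt_norm_sq (hasLineDerivAt_pder (contDiffAt_pder hz 0) j))
      (hasLineDerivAt_norm_sq (hasLineDerivAt_pder (contDiffAt_pder hz 1) j))
  have hG1d : ∀ j, HasLineDerivAt ℝ (G1 j)
      (2 * (⟪pder u 0 y, pder (pder (pder u 0) j) j y⟫
          + ⟪pder (pder u 0) j y, pder (pder u 0) j y⟫)
        + 2 * (⟪pder u 1 y, pder (pder (pder u 1) j) j y⟫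
          + ⟪pder (pder u 1) j y, pder (pder u 1) j y⟫)) y (b2 j) := by
    intro j
    have h : ∀ i, HasLineDerivAt ℝ (fun z => ⟪pder u i z, pder (pder u i) j z⟫)
        (⟪pder u i y, pder (pder (pder u i) j) j y⟫
          + ⟪pder (pder u i) j y, pder (pder u i) j y⟫) y (b2 j) := fun i =>
      hasLineDerivAt_inner (hasLineDerivAt_pder (contDiffAt_pder hy i) j)
        (hasLineDerivAt_pder (contDiffAt_pder (contDiffAt_pder hy i) j) j)
    exact HasDerivAt.add (HasDerivAt.const_mul 2 (h 0)) (HasDerivAt.const_mul 2 (h 1))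
  have key : ∀ j : Fin 2,
      (8 * (y j - x j) ^ 2 - 4 * η y) * gradSq u y
        - 8 * η y * (y j - x j) * G1 j y
        + η y ^ 2 * (2 * (⟪pder u 0 y, pder (pder (pder u 0) j) j y⟫
          + ‖pder (pder u 0) j y‖ ^ 2)
        + 2 * (⟪pder u 1 y, pder (pder (pder u 1) j) j y⟫
          + ‖pder (pder u 1) j y‖ ^ 2))
        + 2 * B * (⟪u y, pder (pder u j) j y⟫ + ‖pder u j y‖ ^ 2) ≤ 0 := by
    intro j
    have hX := hasLineDerivAt_sub_apply x y j
    refine lineDeriv_lineDeriv_nonpos_of_isLocalMax (v := b2 j)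
      (f₁ := fun z => (-(2 * (z j - x j)) * η z + η z * (-(2 * (z j - x j)))) * gradSq u z
        + η z * η z * G1 j z + B * (2 * ⟪u z, pder u j z⟫)) hmax ?_ ?_
    · filter_upwards [eventually_contDiffAt hU hu] with z hz
      exact HasDerivAt.add
        (hasLineDerivAt_mul (hasLineDerivAt_mul (hηd z j) (hηd z j)) (hGd z hz j))
        (HasDerivAt.const_mul B (hasLineDerivAt_norm_sq (hasLineDerivAt_pder hz j)))
    · have h1 := hasLineDerivAt_inner (hasLineDerivAt_pder hy j)
        (hasLineDerivAt_pder (contDiffAt_pder hy j) j)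
      have h2 : HasLineDerivAt ℝ (fun z : E2 => -(2 * (z j - x j))) (-(2 * 1)) y (b2 j) :=
        HasDerivAt.neg (HasDerivAt.const_mul 2 hX)
      have h3 : HasLineDerivAt ℝ
          (fun z => -(2 * (z j - x j)) * η z + η z * (-(2 * (z j - x j)))) _ y (b2 j) :=
        HasDerivAt.add (hasLineDerivAt_mul h2 (hηd y j)) (hasLineDerivAt_mul (hηd y j) h2)
      have := HasDerivAt.add (HasDerivAt.add (hasLineDerivAt_mul h3 (hGd y hy j))
          (hasLineDerivAt_mul (hasLineDerivAt_mul (hηd y j) (hηd y j)) (hG1d j)))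
        (HasDerivAt.const_mul B (HasDerivAt.const_mul 2 h1))
      refine HasDerivAt.congr_deriv this ?_
      simp only [real_inner_self_eq_norm_sq]
      ring
  have cross : ∀ i j : Fin 2, 16 * η y * (y j - x j) * ⟪pder u i y, pder (pder u i) j y⟫
      ≤ 2 * η y ^ 2 * ‖pder (pder u i) j y‖ ^ 2 + 32 * (y j - x j) ^ 2 * ‖pder u i y‖ ^ 2 := by
    intro i j
    have h := sq_nonneg ‖(4 * (y j - x j)) • pder u i y - η y • pder (pder u i) j y‖
    rw [norm_sub_sq_real, norm_smul, norm_smul, inner_smul_left, inner_smul_right, mul_pow,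
      mul_pow, Real.norm_eq_abs, Real.norm_eq_abs, sq_abs, sq_abs] at h
    simp only [conj_trivial] at h
    linarith
  have hS : ‖y - x‖ ^ 2 = (y 0 - x 0) ^ 2 + (y 1 - x 1) ^ 2 := by
    rw [EuclideanSpace.norm_sq_eq, Fin.sum_univ_two]
    simp [sq_abs]
  have hηy : η y = ρ ^ 2 - ((y 0 - x 0) ^ 2 + (y 1 - x 1) ^ 2) := by rw [← hS]
  have hGn : 0 ≤ gradSq u y := by rw [eG]; positivity
  have e : lap u y = pder (pder u 0) 0 y + pder (pder u 1) 1 y := by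
    simp [lap, Fin.sum_univ_two, pder]
  have k0 := key 0
  have k1 := key 1
  have c00 := cross 0 0
  have c01 := cross 0 1
  have c10 := cross 1 0
  have c11 := cross 1 1
  have hfin : (8 * ((y 0 - x 0) ^ 2 + (y 1 - x 1) ^ 2) - 8 * η y
      - 32 * ((y 0 - x 0) ^ 2 + (y 1 - x 1) ^ 2)) * gradSq u y ≥ - (24 * ρ ^ 2) * gradSq u y := by
    apply mul_le_mul_of_nonneg_right _ hGn
    rw [hηy]
    rw [hS] at hyx
    linarith
  have hG : gradSq u y = ‖pder u 0 y‖ ^ 2 + ‖pder u 1 y‖ ^ 2 := by rw [eG]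
  rw [Fin.sum_univ_two, pder_lap hu hU, pder_lap hu hU, e, inner_add_right, inner_add_right,
    inner_add_right]
  change 2 * η y ^ 2 * _ + _ ≤ _
  simp only [G1] at k0 k1
  rw [hG] at k0 k1 hfin ⊢
  linarith

lemma contDiff_gradient {k : ℕ} {V : Evec k → ℝ} (hV : ContDiff ℝ (⊤ : ℕ∞) V) :
    ContDiff ℝ (⊤ : ℕ∞) (gradient V) := by
  have h : ContDiff ℝ (⊤ : ℕ∞) (fderiv ℝ V) := hV.fderiv_right (by simp)
  exact (InnerProductSpace.toDual ℝ (Evec k)).symm.toContinuousLinearEquiv.contDiff.comp h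

lemma continuousOn_pder {k : ℕ} {u : E2 → Evec k} {U : Set E2} (hUo : IsOpen U)
    (hu : ContDiffOn ℝ (⊤ : ℕ∞) u U) (i : Fin 2) : ContinuousOn (pder u i) U := fun _ hz =>
  (contDiffAt_pder (hu.contDiffAt (hUo.mem_nhds hz)) i).continuousAt.continuousWithinAt

lemma continuousOn_gradSq {k : ℕ} {u : E2 → Evec k} {U : Set E2} (hUo : IsOpen U)
    (hu : ContDiffOn ℝ (⊤ : ℕ∞) u U) : ContinuousOn (gradSq u) U := by
  unfold gradSq
  exact continuousOn_finsetSum _ fun i _ => (continuousOn_pder hUo hu i).norm.pow 2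

lemma gradSq_nonneg {k : ℕ} (u : E2 → Evec k) (z : E2) : 0 ≤ gradSq u z :=
  Finset.sum_nonneg fun _ _ => by positivity

lemma pder_lap_of_isSolution {k : ℕ} {V : Evec k → ℝ} (hV : ContDiff ℝ (⊤ : ℕ∞) V) {ε : ℝ}
    {U : Set E2} (hUo : IsOpen U) {u : E2 → Evec k} (hu : IsSolution V ε U u) {y : E2}
    (hy : y ∈ U) (i : Fin 2) :
    pder (lap u) i y = (ε ^ 2)⁻¹ • fderiv ℝ (gradient V) (u y) (pder u i y) := by
  have h : lap u =ᶠ[𝓝 y] fun z => (ε ^ 2)⁻¹ • gradient V (u z) := by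
    filter_upwards [hUo.mem_nhds hy] with z hz using hu.2 z hz
  have hd : HasFDerivAt (fun z => (ε ^ 2)⁻¹ • gradient V (u z)) _ y :=
    (((contDiff_gradient hV).differentiable (by simp) (u y)).hasFDerivAt.comp y
      ((hu.1.contDiffAt (hUo.mem_nhds hy)).differentiableAt (by simp)).hasFDerivAt).const_smul
      (ε ^ 2)⁻¹
  unfold pder
  rw [h.fderiv_eq, hd.fderiv]
  simp

/-- Interior gradient estimate for solutions bounded on a small ball, by Bernstein's method. -/
lemma gradSq_le_of_norm_sq_le {k : ℕ} {V : Evec k → ℝ} (hV : ContDiff ℝ (⊤ : ℕ∞) V) {ε : ℝ}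
    (hε : 0 < ε) {U : Set E2} (hUo : IsOpen U) {u : E2 → Evec k} (hu : IsSolution V ε U u)
    {x : E2} (hball : closedBall x (ε / 4) ⊆ U) {C₀ C₂ L : ℝ} (hC₀ : 0 ≤ C₀) (hL : 0 ≤ L)
    (hgrow : ∀ y, -C₀ ≤ ⟪y, gradient V y⟫)
    (hess : ∀ y : Evec k, ‖y‖ ^ 2 ≤ C₂ → ∀ w, -L * ‖w‖ ^ 2 ≤ ⟪w, fderiv ℝ (gradient V) y w⟫)
    (hbd : ∀ z ∈ closedBall x (ε / 4), ‖u z‖ ^ 2 ≤ C₂) :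
    gradSq u x ≤ (25 + L / 8) / 2 * (2 * C₀ + 16 * C₂) / ε ^ 2 := by
  set ρ := ε / 4 with hρ
  have hρ0 : 0 < ρ := by positivity
  set b := (25 + L / 8) / 2 with hb
  have hb0 : 0 < b := by positivity
  set P : E2 → ℝ := fun z => (ρ ^ 2 - ‖z - x‖ ^ 2) * (ρ ^ 2 - ‖z - x‖ ^ 2) * gradSq u z
      + b * ρ ^ 2 * ‖u z‖ ^ 2 with hP
  have hcont : ContinuousOn P (closedBall x ρ) := by
    have h1 := (continuousOn_gradSq hUo hu.1).mono hball
    have h2 := hu.1.continuousOn.mono hball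
    fun_prop
  have hxm : x ∈ closedBall x ρ := mem_closedBall_self hρ0.le
  obtain ⟨y, hy, hmax⟩ := (isCompact_closedBall x ρ).exists_isMaxOn ⟨x, hxm⟩ hcont
  have hPx : ρ ^ 4 * gradSq u x ≤ P y := by
    have h1 : P x ≤ P y := hmax hxm
    have h2 : P x = ρ ^ 4 * gradSq u x + b * ρ ^ 2 * ‖u x‖ ^ 2 := by
      simp only [hP, sub_self, norm_zero]
      ring
    have h3 : 0 ≤ b * ρ ^ 2 * ‖u x‖ ^ 2 := by positivity
    linarith
  have hyn : ‖y - x‖ ≤ ρ := by rwa [← dist_eq_norm]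
  have hy2 : ‖y - x‖ ^ 2 ≤ ρ ^ 2 := by gcongr
  have huy := hbd y hy
  have hPy : P y ≤ ρ ^ 2 * (b * (C₀ / 8 + C₂)) := by
    have hu' : b * ρ ^ 2 * ‖u y‖ ^ 2 ≤ b * ρ ^ 2 * C₂ := by gcongr
    rcases hyn.lt_or_eq with hlt | heq
    · have hnhds : closedBall x ρ ∈ 𝓝 y := by
        refine mem_of_superset (isOpen_ball.mem_nhds ?_) ball_subset_closedBall
        rwa [mem_ball, dist_eq_norm]
      have hU : U ∈ 𝓝 y := hUo.mem_nhds (hball hy)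
      have hB := bernstein_le_of_isLocalMax hu.1 hU hy2 (hmax.isLocalMax hnhds)
      rw [hu.2 y (hball hy), inner_smul_right] at hB
      have hG := gradSq_nonneg u y
      have hsum : -(L * (ε ^ 2)⁻¹) * gradSq u y
          ≤ ∑ i : Fin 2, ⟪pder u i y, pder (lap u) i y⟫ := by
        rw [gradSq, Finset.mul_sum]
        refine Finset.sum_le_sum fun i _ => ?_
        rw [pder_lap_of_isSolution hV hUo hu (hball hy), inner_smul_right]
        have := mul_le_mul_of_nonneg_left (hess (u y) huy (pder u i y))
          (inv_nonneg.2 (sq_nonneg ε))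
        linarith
      have hη0 : 0 ≤ ρ ^ 2 - ‖y - x‖ ^ 2 := by linarith
      have hη1 : ρ ^ 2 - ‖y - x‖ ^ 2 ≤ ρ ^ 2 := by linarith [sq_nonneg ‖y - x‖]
      have hη2 : (ρ ^ 2 - ‖y - x‖ ^ 2) ^ 2 ≤ (ρ ^ 2) ^ 2 := by gcongr
      have t1 : -(L / 8) * ρ ^ 2 * gradSq u y ≤ 2 * (ρ ^ 2 - ‖y - x‖ ^ 2) ^ 2
          * (∑ i : Fin 2, ⟪pder u i y, pder (lap u) i y⟫) := by
        have s1 := mul_le_mul_of_nonneg_left hsum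
          (show 0 ≤ 2 * (ρ ^ 2 - ‖y - x‖ ^ 2) ^ 2 by positivity)
        have s2 := mul_le_mul_of_nonneg_right hη2
          (show 0 ≤ 2 * (L * (ε ^ 2)⁻¹ * gradSq u y) by positivity)
        have s3 : (ρ ^ 2) ^ 2 * (2 * (L * (ε ^ 2)⁻¹ * gradSq u y))
            = (L / 8) * ρ ^ 2 * gradSq u y := by
          rw [hρ]
          field_simp
          ring
        linarith
      have t2 : -(2 * b * ρ ^ 2) * ((ε ^ 2)⁻¹ * C₀)
          ≤ 2 * (b * ρ ^ 2) * ((ε ^ 2)⁻¹ * ⟪u y, gradient V (u y)⟫) := by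
        have := mul_le_mul_of_nonneg_left (hgrow (u y))
          (show 0 ≤ 2 * (b * ρ ^ 2) * (ε ^ 2)⁻¹ by positivity)
        linarith
      have t3 : ρ ^ 2 * gradSq u y ≤ ρ ^ 2 * (2 * b * ((ε ^ 2)⁻¹ * C₀)) := by
        have : 2 * (b * ρ ^ 2) * gradSq u y = (25 + L / 8) * ρ ^ 2 * gradSq u y := by
          rw [hb]
          ring
        linarith
      have t4 : (ρ ^ 2 - ‖y - x‖ ^ 2) * (ρ ^ 2 - ‖y - x‖ ^ 2) * gradSq u y
          ≤ ρ ^ 2 * (ρ ^ 2 * gradSq u y) := by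
        rw [← mul_assoc]
        gcongr
      have t5 : ρ ^ 2 * (ρ ^ 2 * (2 * b * ((ε ^ 2)⁻¹ * C₀))) = ρ ^ 2 * (b * (C₀ / 8)) := by
        rw [hρ]
        field_simp
        ring
      have t6 := mul_le_mul_of_nonneg_left t3 (sq_nonneg ρ)
      simp only [hP]
      linarith
    · simp only [hP, heq, sub_self, zero_mul, zero_add]
      have : 0 ≤ ρ ^ 2 * (b * (C₀ / 8)) := by positivity
      linarith
  have hle : ρ ^ 2 * gradSq u x ≤ b * (C₀ / 8 + C₂) := by
    refine le_of_mul_le_mul_left ?_ (sq_pos_of_pos hρ0)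
    calc ρ ^ 2 * (ρ ^ 2 * gradSq u x) = ρ ^ 4 * gradSq u x := by ring
      _ ≤ _ := hPx.trans hPy
  rw [le_div_iff₀ (by positivity)]
  have : ρ ^ 2 = ε ^ 2 / 16 := by rw [hρ]; ring
  rw [this] at hle
  linarith

/-- A solution dominated by a quadratic barrier on the boundary of a rectangle. -/
lemma norm_sq_le_add_barrier {k : ℕ} {V : Evec k → ℝ} {ε : ℝ} (hε : 0 < ε)
    {U : Set E2} (hUo : IsOpen U) {u : E2 → Evec k} (hu : IsSolution V ε U u) {x : E2}
    {α C₀ A : ℝ} (hα : 0 < α) (hC₀ : 0 ≤ C₀) (hA : 0 ≤ A)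
    (hgrow : ∀ y, α * ‖y‖ ^ 2 - C₀ ≤ ⟪y, gradient V y⟫) {s : Set E2} (hs : IsCompact s)
    (hsU : s ⊆ U) (hfr : ∀ z ∈ s, z ∉ interior s → ‖u z‖ ^ 2 ≤ A * ‖z - x‖ ^ 2)
    {z : E2} (hz : z ∈ s) :
    ‖u z‖ ^ 2 ≤ (2 * A * ε ^ 2 + C₀) / α + A * ‖z - x‖ ^ 2 := by
  have hcont : ContinuousOn (fun z => ‖u z‖ ^ 2 - A * ‖z - x‖ ^ 2) s := by
    have h2 := hu.1.continuousOn.mono hsU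
    fun_prop
  obtain ⟨y, hy, hmax⟩ := hs.exists_isMaxOn ⟨z, hz⟩ hcont
  have h1 : ‖u z‖ ^ 2 - A * ‖z - x‖ ^ 2 ≤ ‖u y‖ ^ 2 - A * ‖y - x‖ ^ 2 := hmax hz
  have h2 : ‖u y‖ ^ 2 - A * ‖y - x‖ ^ 2 ≤ (2 * A * ε ^ 2 + C₀) / α := by
    by_cases hi : y ∈ interior s
    · have h := gradSq_add_inner_lap_le hu.1 (hUo.mem_nhds (hsU hy))
        (hmax.isLocalMax (mem_interior_iff_mem_nhds.1 hi))
      rw [hu.2 y (hsU hy), inner_smul_right] at h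
      have hG := gradSq_nonneg u y
      have h3 : (ε ^ 2)⁻¹ * ⟪u y, gradient V (u y)⟫ ≤ 2 * A := by linarith
      rw [inv_mul_le_iff₀ (by positivity)] at h3
      have h4 : ‖u y‖ ^ 2 ≤ (2 * A * ε ^ 2 + C₀) / α := by
        rw [le_div_iff₀ hα]
        linarith [hgrow (u y)]
      have : 0 ≤ A * ‖y - x‖ ^ 2 := by positivity
      linarith
    · have := hfr y hy hi
      have : 0 ≤ (2 * A * ε ^ 2 + C₀) / α := by positivity
      linarith
  linarith

lemma measurePreserving_smul_b2_add_smul_b2 {a b : Fin 2} (hab : a ≠ b) :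
    MeasurePreserving (fun p : ℝ × ℝ => p.1 • b2 a + p.2 • b2 b) := by
  have h01 : MeasurePreserving (fun p : ℝ × ℝ => p.1 • b2 0 + p.2 • b2 1) := by
    have h := (PiLp.volume_preserving_toLp (Fin 2)).comp (volume_preserving_finTwoArrow ℝ).symm
    have e : (fun p : ℝ × ℝ => p.1 • b2 0 + p.2 • b2 1)
        = WithLp.toLp 2 ∘ MeasurableEquiv.finTwoArrow.symm := by
      funext p
      ext i
      fin_cases i <;> simp [b2, MeasurableEquiv.finTwoArrow]
    rw [e]
    exact h
  have h10 : MeasurePreserving (fun p : ℝ × ℝ => p.1 • b2 1 + p.2 • b2 0) := by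
    have h := h01.comp (Measure.measurePreserving_swap (μ := (volume : Measure ℝ))
      (ν := (volume : Measure ℝ)))
    have e : (fun p : ℝ × ℝ => p.1 • b2 1 + p.2 • b2 0)
        = (fun p : ℝ × ℝ => p.1 • b2 0 + p.2 • b2 1) ∘ Prod.swap := by
      funext p
      simp [add_comm]
    rw [e]
    exact h
  fin_cases a <;> fin_cases b <;> simp_all

lemma smul_b2_add_smul_b2_apply {a b : Fin 2} (hab : a ≠ b) (s t : ℝ) :
    (s • b2 a + t • b2 b) a = s ∧ (s • b2 a + t • b2 b) b = t := by
  simp [b2, hab, hab.symm]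

lemma eq_smul_b2_add_smul_b2 {a b : Fin 2} (hab : a ≠ b) (z : E2) :
    z = z a • b2 a + z b • b2 b := by
  ext i
  fin_cases a <;> fin_cases b <;> fin_cases i <;> simp_all [b2]

/-- Among parallel segments there is one with controlled integral. -/
lemma exists_segment_integral_le {a b : Fin 2} (hab : a ≠ b) {e : E2 → ℝ} {p₁ p₂ q₁ q₂ M : ℝ}
    (hp : p₁ < p₂)
    (he : IntegrableOn e {z | z a ∈ Set.Icc p₁ p₂ ∧ z b ∈ Set.Icc q₁ q₂})
    (hM : ∫ z in {z | z a ∈ Set.Icc p₁ p₂ ∧ z b ∈ Set.Icc q₁ q₂}, e z ≤ M) :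
    ∃ s ∈ Set.Icc p₁ p₂, ∫ t in Set.Icc q₁ q₂, e (s • b2 a + t • b2 b) ≤ M / (p₂ - p₁) := by
  have hmp := measurePreserving_smul_b2_add_smul_b2 hab
  have hemb : MeasurableEmbedding (fun p : ℝ × ℝ => p.1 • b2 a + p.2 • b2 b) := by
    refine Continuous.measurableEmbedding (by fun_prop) fun p q hpq => ?_
    have h1 := smul_b2_add_smul_b2_apply hab p.1 p.2
    have h2 := smul_b2_add_smul_b2_apply hab q.1 q.2
    rw [show p.1 • b2 a + p.2 • b2 b = q.1 • b2 a + q.2 • b2 b from hpq] at h1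
    exact Prod.ext (h1.1.symm.trans h2.1) (h1.2.symm.trans h2.2)
  have hpre : (fun p : ℝ × ℝ => p.1 • b2 a + p.2 • b2 b) ⁻¹'
      {z | z a ∈ Set.Icc p₁ p₂ ∧ z b ∈ Set.Icc q₁ q₂} = Set.Icc p₁ p₂ ×ˢ Set.Icc q₁ q₂ := by
    ext p
    simp only [Set.mem_preimage, Set.mem_ofPred_eq, Set.mem_prod,
      (smul_b2_add_smul_b2_apply hab p.1 p.2).1, (smul_b2_add_smul_b2_apply hab p.1 p.2).2]
  have hint : IntegrableOn (fun p : ℝ × ℝ => e (p.1 • b2 a + p.2 • b2 b))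
      (Set.Icc p₁ p₂ ×ˢ Set.Icc q₁ q₂) (volume.prod volume) := by
    rw [← hpre]
    exact (hmp.integrableOn_comp_preimage hemb).2 he
  rw [← hmp.setIntegral_preimage_emb hemb, hpre, Measure.volume_eq_prod,
    setIntegral_prod _ hint] at hM
  have hint' := hint
  rw [IntegrableOn, ← Measure.prod_restrict] at hint'
  obtain ⟨s, hs, hle⟩ := exists_le_setAverage (μ := volume) (s := Set.Icc p₁ p₂)
    (f := fun s => ∫ t in Set.Icc q₁ q₂, e (s • b2 a + t • b2 b))
    (by simpa using hp) (by simp) hint'.integral_prod_left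
  refine ⟨s, hs, hle.trans ?_⟩
  rw [setAverage_eq, smul_eq_mul, measureReal_def, Real.volume_Icc,
    ENNReal.toReal_ofReal (by linarith), inv_mul_eq_div]
  have : 0 < p₂ - p₁ := by linarith
  gcongr

/-- A curve whose one-dimensional energy is bounded is bounded. -/
lemma norm_le_of_integral_energy_le {k : ℕ} {V : Evec k → ℝ} (hV : ∀ y, 0 ≤ V y) {ε : ℝ}
    (hε : 0 < ε) (hε1 : ε ≤ 1) {c d m R : ℝ} (hcd : c < d)
    (hR : ∀ y, V y ≤ m / (d - c) → ‖y‖ ≤ R) {w w' : ℝ → Evec k} {f : ℝ → ℝ}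
    (hw : ∀ t ∈ Set.Icc c d, HasDerivAt w (w' t) t) (hw' : ContinuousOn w' (Set.Icc c d))
    (hf : ContinuousOn f (Set.Icc c d))
    (hfe : ∀ t ∈ Set.Icc c d, ε / 2 * ‖w' t‖ ^ 2 + ε⁻¹ * V (w t) ≤ f t)
    (hm : ∫ t in Set.Icc c d, f t ≤ m) {t : ℝ} (ht : t ∈ Set.Icc c d) :
    ‖w t‖ ≤ R + (d - c) + 2 * m / ε := by
  have hfi : IntegrableOn f (Set.Icc c d) := hf.integrableOn_Icc
  have hdc : 0 < d - c := by linarith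
  obtain ⟨s, hs, hle⟩ := exists_le_setAverage (μ := volume) (s := Set.Icc c d)
    (f := f) (by simpa using hcd) (by simp) hfi
  have hws : ‖w s‖ ≤ R := by
    apply hR
    rw [setAverage_eq, smul_eq_mul, measureReal_def, Real.volume_Icc,
      ENNReal.toReal_ofReal hdc.le, inv_mul_eq_div] at hle
    have h1 : V (w s) ≤ ε⁻¹ * V (w s) :=
      le_mul_of_one_le_left (hV _) ((one_le_inv₀ hε).2 hε1)
    have h2 : 0 ≤ ε / 2 * ‖w' s‖ ^ 2 := by positivity
    have h3 : (∫ t in Set.Icc c d, f t) / (d - c) ≤ m / (d - c) := by gcongr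
    linarith [hfe s hs]
  have hsub : Set.uIcc s t ⊆ Set.Icc c d := Set.uIcc_subset_Icc hs ht
  have hftc : ∫ r in s..t, w' r = w t - w s :=
    intervalIntegral.integral_eq_sub_of_hasDerivAt (fun r hr => hw r (hsub hr))
      (hw'.mono hsub).intervalIntegrable
  have hpt : ∀ r ∈ Set.Icc c d, ‖w' r‖ ≤ 1 + 2 / ε * f r := by
    intro r hr
    have h1 := hfe r hr
    have h2 : 0 ≤ ε⁻¹ * V (w r) := mul_nonneg (inv_nonneg.2 hε.le) (hV _)
    have h3 : ‖w' r‖ ^ 2 ≤ 2 / ε * f r := by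
      rw [div_mul_eq_mul_div, le_div_iff₀ hε]
      linarith
    nlinarith [sq_nonneg (‖w' r‖ - 1), sq_nonneg ‖w' r‖]
  have hgi : IntegrableOn (fun r => 1 + 2 / ε * f r) (Set.Icc c d) :=
    (continuousOn_const.add (continuousOn_const.mul hf)).integrableOn_Icc
  have hbound : ‖w t - w s‖ ≤ (d - c) + 2 * m / ε := by
    rw [← hftc]
    calc ‖∫ r in s..t, w' r‖ ≤ ∫ r in Set.uIoc s t, ‖w' r‖ :=
          intervalIntegral.norm_integral_le_integral_norm_uIoc
      _ ≤ ∫ r in Set.Icc c d, ‖w' r‖ :=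
          setIntegral_mono_set hw'.norm.integrableOn_Icc
            (Eventually.of_forall fun _ => norm_nonneg _)
            (Set.uIoc_subset_uIcc.trans hsub).eventuallyLE
      _ ≤ ∫ r in Set.Icc c d, (1 + 2 / ε * f r) :=
          setIntegral_mono_on hw'.norm.integrableOn_Icc hgi measurableSet_Icc hpt
      _ = (d - c) + 2 / ε * ∫ r in Set.Icc c d, f r := by
          rw [integral_add (integrable_const _) (hfi.const_mul _), integral_const_mul]
          simp [hcd.le]
      _ ≤ (d - c) + 2 / ε * m := by gcongr
      _ = _ := by ring
  have := norm_le_norm_add_norm_sub' (w t) (w s)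
  linarith

/-- Among parallel segments filling a rectangle there is one on which the solution is bounded. -/
lemma exists_segment_norm_le {k : ℕ} {V : Evec k → ℝ} (hV : ContDiff ℝ (⊤ : ℕ∞) V)
    (hV0 : ∀ y, 0 ≤ V y) {ε : ℝ} (hε : 0 < ε) (hε1 : ε ≤ 1) {U : Set E2} (hUo : IsOpen U)
    {u : E2 → Evec k} (hu : ContDiffOn ℝ (⊤ : ℕ∞) u U) (hint : IntegrableOn (eDens V ε u) U)
    {M : ℝ} (hM : energy V ε u U ≤ M) {a b : Fin 2} (hab : a ≠ b) {p₁ p₂ q₁ q₂ R : ℝ}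
    (hp : p₁ < p₂) (hq : q₁ < q₂)
    (hU : {z : E2 | z a ∈ Set.Icc p₁ p₂ ∧ z b ∈ Set.Icc q₁ q₂} ⊆ U)
    (hR : ∀ y, V y ≤ M / (p₂ - p₁) / (q₂ - q₁) → ‖y‖ ≤ R) :
    ∃ s ∈ Set.Icc p₁ p₂, ∀ z : E2, z a = s → z b ∈ Set.Icc q₁ q₂ →
      ‖u z‖ ≤ R + (q₂ - q₁) + 2 * (M / (p₂ - p₁)) / ε := by
  have hnn : ∀ z, 0 ≤ eDens V ε u z := fun z => by
    have := gradSq_nonneg u z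
    have := hV0 (u z)
    unfold eDens
    positivity
  obtain ⟨s, hs, hle⟩ := exists_segment_integral_le hab hp (hint.mono_set hU)
    ((setIntegral_mono_set hint (Eventually.of_forall hnn) hU.eventuallyLE).trans hM)
  refine ⟨s, hs, fun z hza hzb => ?_⟩
  have hmaps : Set.MapsTo (fun t : ℝ => s • b2 a + t • b2 b) (Set.Icc q₁ q₂) U := by
    intro t ht
    apply hU
    rw [Set.mem_ofPred_eq, (smul_b2_add_smul_b2_apply hab s t).1,
      (smul_b2_add_smul_b2_apply hab s t).2]
    exact ⟨hs, ht⟩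
  have hlc : Continuous (fun t : ℝ => s • b2 a + t • b2 b) := by fun_prop
  have hec : ContinuousOn (eDens V ε u) U := by
    have h1 := continuousOn_gradSq hUo hu
    have h2 := hV.continuous.comp_continuousOn hu.continuousOn
    exact (h1.const_mul _).add (h2.const_mul _)
  have key := norm_le_of_integral_energy_le hV0 hε hε1 hq hR
    (w := fun t => u (s • b2 a + t • b2 b)) (w' := fun t => pder u b (s • b2 a + t • b2 b))
    (f := fun t => eDens V ε u (s • b2 a + t • b2 b)) ?_
    ((continuousOn_pder hUo hu b).comp hlc.continuousOn hmaps)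
    (hec.comp hlc.continuousOn hmaps) ?_ hle hzb
  · simp only at key
    rwa [← hza, ← eq_smul_b2_add_smul_b2 hab z] at key
  · intro t ht
    have h1 := ((hu.contDiffAt (hUo.mem_nhds (hmaps ht))).differentiableAt (by simp)).hasFDerivAt
    have h2 : HasDerivAt (fun t : ℝ => s • b2 a + t • b2 b) (b2 b) t := by
      simpa using ((hasDerivAt_id t).smul_const (b2 b)).const_add (s • b2 a)
    exact h1.comp_hasDerivAt t h2
  · intro t _
    have : ‖pder u b (s • b2 a + t • b2 b)‖ ^ 2 ≤ gradSq u (s • b2 a + t • b2 b) :=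
      Finset.single_le_sum (f := fun i => ‖pder u i (s • b2 a + t • b2 b)‖ ^ 2)
        (fun _ _ => by positivity) (Finset.mem_univ b)
    unfold eDens
    gcongr

lemma norm_sub_sq_eq_fin_two (x z : E2) :
    ‖z - x‖ ^ 2 = (z 0 - x 0) ^ 2 + (z 1 - x 1) ^ 2 := by
  rw [EuclideanSpace.norm_sq_eq, Fin.sum_univ_two]
  simp [sq_abs]

lemma mem_ball_of_abs_sub_le {x z : E2} {δ : ℝ} (hδ : 0 < δ) (hz : ∀ i, |z i - x i| ≤ δ / 2) :
    z ∈ ball x δ := by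
  rw [mem_ball, dist_eq_norm]
  refine lt_of_pow_lt_pow_left₀ 2 hδ.le ?_
  rw [norm_sub_sq_eq_fin_two]
  have h0 := sq_le_sq' (abs_le.1 (hz 0)).1 (abs_le.1 (hz 0)).2
  have h1 := sq_le_sq' (abs_le.1 (hz 1)).1 (abs_le.1 (hz 1)).2
  nlinarith

/-- If a solution is bounded on suitable horizontal and vertical segments surrounding `x`, then it
is bounded near `x`. -/
lemma norm_sq_le_of_segments {k : ℕ} {V : Evec k → ℝ} {ε : ℝ} (hε : 0 < ε) {U : Set E2}
    (hUo : IsOpen U) {u : E2 → Evec k} (hu : IsSolution V ε U u) {x : E2} {α C₀ δ B : ℝ}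
    (hα : 0 < α) (hC₀ : 0 ≤ C₀) (hδ : 0 < δ) (hεδ : ε ≤ δ / 2)
    (hgrow : ∀ y, α * ‖y‖ ^ 2 - C₀ ≤ ⟪y, gradient V y⟫) (hball : ball x δ ⊆ U)
    (hline : ∀ a b : Fin 2, a ≠ b → ∀ p₁ p₂ : ℝ, p₂ - p₁ = δ / 4 → x a - δ / 2 ≤ p₁ →
      p₂ ≤ x a + δ / 2 → ∃ s ∈ Set.Icc p₁ p₂, ∀ z : E2, z a = s →
        z b ∈ Set.Icc (x b - δ / 2) (x b + δ / 2) → ‖u z‖ ≤ B)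
    {z : E2} (hz : z ∈ closedBall x (ε / 4)) :
    ‖u z‖ ^ 2 ≤ (32 * (B * ε) ^ 2 / δ ^ 2 + C₀) / α + (B * ε) ^ 2 / δ ^ 2 := by
  obtain ⟨s₀, ⟨hs₀, hs₀'⟩, hs₀u⟩ := hline 0 1 (by decide) (x 0 - δ / 2) (x 0 - δ / 4)
    (by ring) (by linarith) (by linarith)
  obtain ⟨s₁, ⟨hs₁, hs₁'⟩, hs₁u⟩ := hline 0 1 (by decide) (x 0 + δ / 4) (x 0 + δ / 2)
    (by ring) (by linarith) (by linarith)
  obtain ⟨t₀, ⟨ht₀, ht₀'⟩, ht₀u⟩ := hline 1 0 (by decide) (x 1 - δ / 2) (x 1 - δ / 4)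
    (by ring) (by linarith) (by linarith)
  obtain ⟨t₁, ⟨ht₁, ht₁'⟩, ht₁u⟩ := hline 1 0 (by decide) (x 1 + δ / 4) (x 1 + δ / 2)
    (by ring) (by linarith) (by linarith)
  set A := 16 * B ^ 2 / δ ^ 2 with hA
  have hA0 : 0 ≤ A := by positivity
  set Q : Set E2 := {z | (s₀ ≤ z 0 ∧ z 0 ≤ s₁) ∧ t₀ ≤ z 1 ∧ z 1 ≤ t₁} with hQ
  have hc : ∀ i : Fin 2, Continuous fun z : E2 => z i := fun i => by fun_prop
  have hQball : Q ⊆ ball x δ := by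
    rintro z ⟨⟨h1, h2⟩, h3, h4⟩
    refine mem_ball_of_abs_sub_le hδ fun i => ?_
    fin_cases i <;> simp only [Fin.zero_eta, Fin.mk_one] <;> rw [abs_le] <;> constructor <;>
      linarith
  have hQclosed : IsClosed Q :=
    ((isClosed_le continuous_const (hc 0)).inter (isClosed_le (hc 0) continuous_const)).inter
      ((isClosed_le continuous_const (hc 1)).inter (isClosed_le (hc 1) continuous_const))
  have hQcompact : IsCompact Q :=
    (isCompact_closedBall x δ).of_isClosed_subset hQclosed (hQball.trans ball_subset_closedBall)
  have hopen : {z : E2 | (s₀ < z 0 ∧ z 0 < s₁) ∧ t₀ < z 1 ∧ z 1 < t₁} ⊆ interior Q := by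
    refine interior_maximal (fun z hz => ⟨⟨hz.1.1.le, hz.1.2.le⟩, hz.2.1.le, hz.2.2.le⟩) ?_
    exact ((isOpen_lt continuous_const (hc 0)).inter (isOpen_lt (hc 0) continuous_const)).inter
      ((isOpen_lt continuous_const (hc 1)).inter (isOpen_lt (hc 1) continuous_const))
  have hfr : ∀ z ∈ Q, z ∉ interior Q → ‖u z‖ ^ 2 ≤ A * ‖z - x‖ ^ 2 := by
    intro z hz hzi
    obtain ⟨⟨h1, h2⟩, h3, h4⟩ := hz
    have hz0 : z 0 ∈ Set.Icc (x 0 - δ / 2) (x 0 + δ / 2) := ⟨by linarith, by linarith⟩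
    have hz1 : z 1 ∈ Set.Icc (x 1 - δ / 2) (x 1 + δ / 2) := ⟨by linarith, by linarith⟩
    have hkey : ‖u z‖ ≤ B ∧ δ ^ 2 / 16 ≤ ‖z - x‖ ^ 2 := by
      rw [norm_sub_sq_eq_fin_two]
      rcases h1.eq_or_lt with h | h1
      · exact ⟨hs₀u z h.symm hz1, by nlinarith [sq_nonneg (z 1 - x 1)]⟩
      rcases h2.eq_or_lt with h | h2
      · exact ⟨hs₁u z h hz1, by nlinarith [sq_nonneg (z 1 - x 1)]⟩
      rcases h3.eq_or_lt with h | h3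
      · exact ⟨ht₀u z h.symm hz0, by nlinarith [sq_nonneg (z 0 - x 0)]⟩
      rcases h4.eq_or_lt with h | h4
      · exact ⟨ht₁u z h hz0, by nlinarith [sq_nonneg (z 0 - x 0)]⟩
      exact absurd (hopen ⟨⟨h1, h2⟩, h3, h4⟩) hzi
    calc ‖u z‖ ^ 2 ≤ B ^ 2 := by
          have := hkey.1
          gcongr
      _ = A * (δ ^ 2 / 16) := by
          rw [hA]
          field_simp
      _ ≤ A * ‖z - x‖ ^ 2 := mul_le_mul_of_nonneg_left hkey.2 hA0
  have hsmall : closedBall x (ε / 4) ⊆ Q := by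
    intro z hz
    rw [mem_closedBall, dist_eq_norm] at hz
    have h : ∀ i : Fin 2, |z i - x i| ≤ δ / 8 := fun i => by
      have := PiLp.norm_apply_le (z - x) i
      rw [PiLp.sub_apply, Real.norm_eq_abs] at this
      linarith
    have h0 := abs_le.1 (h 0)
    have h1 := abs_le.1 (h 1)
    exact ⟨⟨by linarith, by linarith⟩, by linarith, by linarith⟩
  have h1 := norm_sq_le_add_barrier hε hUo hu hα hC₀ hA0 hgrow hQcompact
    (hQball.trans hball) hfr (hsmall hz)
  rw [mem_closedBall, dist_eq_norm] at hz
  have h2 : A * ‖z - x‖ ^ 2 ≤ A * (ε / 4) ^ 2 := by gcongr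
  have h3 : A * (ε / 4) ^ 2 = (B * ε) ^ 2 / δ ^ 2 := by
    rw [hA]
    field_simp
    ring
  have h4 : 2 * A * ε ^ 2 = 32 * (B * ε) ^ 2 / δ ^ 2 := by
    rw [hA]
    field_simp
    ring
  rw [h4] at h1
  linarith

/-- interior gradient bound. For every `M, δ > 0` there is
`K > 0` depending only on `V`, `M` and `δ` such that for every solution `u_ε`
on a bounded open `Ω ⊂ ℝ²` with `0 < ε ≤ δ/2`, `ε ≤ 1` and `E_ε(u_ε,Ω) ≤ M`,
one has `|∇u_ε(x)| ≤ K/ε` at every `x ∈ Ω` with `dist(x,∂Ω) ≥ δ`. -/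
theorem statement_16 (k : ℕ) (hk : 1 ≤ k) (V : Evec k → ℝ) (hV : IsMultiWell V)
    (M δ : ℝ) (hM : 0 < M) (hδ : 0 < δ) :
    ∃ K > (0 : ℝ),
      ∀ (Ω : Set E2), IsOpen Ω → IsBounded Ω →
      ∀ ε : ℝ, 0 < ε → ε ≤ δ / 2 → ε ≤ 1 →
      ∀ u : E2 → Evec k, IsSolution V ε Ω u →
        IntegrableOn (eDens V ε u) Ω →
        energy V ε u Ω ≤ M →
        ∀ x ∈ Ω, δ ≤ infDist x Ωᶜ →
          Real.sqrt (gradSq u x) ≤ K / ε := by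
  obtain ⟨α, hα, R₀, hR₀, hgr⟩ := hV.growth
  have hVc : Continuous (gradient V) := (contDiff_gradient hV.smooth).continuous
  obtain ⟨C, hC⟩ := (isCompact_closedBall (0 : Evec k) R₀).bddAbove_image
    (f := fun y => α * ‖y‖ ^ 2 - ⟪y, gradient V y⟫) (by fun_prop)
  set C₀ := max C 0 with hC₀def
  have hC₀ : 0 ≤ C₀ := le_max_right _ _
  have hgrow : ∀ y, α * ‖y‖ ^ 2 - C₀ ≤ ⟪y, gradient V y⟫ := by
    intro y
    by_cases hy : R₀ < ‖y‖
    · linarith [hgr y hy]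
    · have h1 : α * ‖y‖ ^ 2 - ⟪y, gradient V y⟫ ≤ C := hC (Set.mem_image_of_mem _ (show y ∈ closedBall (0 : Evec k) R₀ by
        simpa using not_lt.1 hy))
      linarith [le_max_left C 0]
  set m := M / (δ / 4) with hm
  have hm0 : 0 < m := by positivity
  obtain ⟨R₁, hR₁⟩ := hV.coercive (m / δ + 1)
  have hR : ∀ y, V y ≤ m / δ → ‖y‖ ≤ |R₁| := by
    intro y hy
    by_contra! hlt
    linarith [hR₁ y ((le_abs_self R₁).trans hlt.le)]
  set C₃ := |R₁| + δ + 2 * m with hC₃def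
  have hC₃ : 0 < C₃ := by positivity
  set C₂ := (32 * C₃ ^ 2 / δ ^ 2 + C₀) / α + C₃ ^ 2 / δ ^ 2 with hC₂def
  have hC₂ : 0 ≤ C₂ := by positivity
  obtain ⟨L', hL'⟩ := (isCompact_closedBall (0 : Evec k) (Real.sqrt C₂)).bddAbove_image
    (f := fun y => ‖fderiv ℝ (gradient V) y‖)
    ((contDiff_gradient hV.smooth).continuous_fderiv (by simp)).norm.continuousOn
  set L := max L' 0 with hLdef
  have hL : 0 ≤ L := le_max_right _ _
  have hess : ∀ y : Evec k, ‖y‖ ^ 2 ≤ C₂ →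
      ∀ w, -L * ‖w‖ ^ 2 ≤ ⟪w, fderiv ℝ (gradient V) y w⟫ := by
    intro y hy w
    have h1 : ‖fderiv ℝ (gradient V) y‖ ≤ L :=
      (hL' (Set.mem_image_of_mem _ (show y ∈ closedBall (0 : Evec k) (Real.sqrt C₂) by
        simpa using Real.le_sqrt_of_sq_le hy))).trans (le_max_left _ _)
    have h2 : ‖⟪w, fderiv ℝ (gradient V) y w⟫‖ ≤ ‖w‖ * (L * ‖w‖) :=
      (norm_inner_le_norm _ _).trans
        (mul_le_mul_of_nonneg_left (ContinuousLinearMap.le_of_opNorm_le _ h1 w) (norm_nonneg w))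
    have h3 := neg_le_of_abs_le h2
    linarith
  set K₂ := (25 + L / 8) / 2 * (2 * C₀ + 16 * C₂) with hK₂
  refine ⟨Real.sqrt K₂ + 1, by positivity, ?_⟩
  intro Ω hΩ _ ε hε hεδ hε1 u hu hint hen x hx hdist
  have hballΩ : ball x δ ⊆ Ω := by
    intro z hz
    by_contra hzΩ
    have := infDist_le_dist_of_mem (x := x) (show z ∈ Ωᶜ from hzΩ)
    rw [mem_ball, dist_comm] at hz
    linarith
  have hline : ∀ a b : Fin 2, a ≠ b → ∀ p₁ p₂ : ℝ, p₂ - p₁ = δ / 4 → x a - δ / 2 ≤ p₁ →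
      p₂ ≤ x a + δ / 2 → ∃ s ∈ Set.Icc p₁ p₂, ∀ z : E2, z a = s →
        z b ∈ Set.Icc (x b - δ / 2) (x b + δ / 2) → ‖u z‖ ≤ C₃ / ε := by
    intro a b hab p₁ p₂ hp h1 h2
    have hq : x b + δ / 2 - (x b - δ / 2) = δ := by ring
    have hsub : {z : E2 | z a ∈ Set.Icc p₁ p₂ ∧ z b ∈ Set.Icc (x b - δ / 2) (x b + δ / 2)}
        ⊆ Ω := by
      rintro z ⟨⟨ha1, ha2⟩, hb1, hb2⟩
      refine hballΩ (mem_ball_of_abs_sub_le hδ fun i => ?_)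
      have hi : i = a ∨ i = b := by
        fin_cases i <;> fin_cases a <;> fin_cases b <;> simp_all
      rcases hi with rfl | rfl <;> rw [abs_le] <;> constructor <;> linarith
    obtain ⟨s, hs, hsz⟩ := exists_segment_norm_le hV.smooth hV.nonneg hε hε1 hΩ hu.1 hint hen hab
      (by linarith) (by linarith) hsub (R := |R₁|) (by rw [hp, hq]; exact hR)
    refine ⟨s, hs, fun z hza hzb => (hsz z hza hzb).trans ?_⟩
    rw [hp, hq, ← hm, hC₃def, add_div]
    have : |R₁| + δ ≤ (|R₁| + δ) / ε := le_div_self (by positivity) hε hε1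
    linarith
  have hbd : ∀ z ∈ closedBall x (ε / 4), ‖u z‖ ^ 2 ≤ C₂ := by
    intro z hz
    have h := norm_sq_le_of_segments hε hΩ hu hα hC₀ hδ hεδ hgrow hballΩ hline hz
    rwa [div_mul_cancel₀ _ hε.ne'] at h
  have hgrad := gradSq_le_of_norm_sq_le hV.smooth hε hΩ hu
    ((closedBall_subset_ball (by linarith)).trans hballΩ) hC₀ hL
    (fun y => (by linarith [hgrow y, mul_nonneg hα.le (sq_nonneg ‖y‖)])) hess hbd
  calc Real.sqrt (gradSq u x) ≤ Real.sqrt (K₂ / ε ^ 2) := Real.sqrt_le_sqrt hgrad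
    _ = Real.sqrt K₂ / ε := by rw [Real.sqrt_div (by positivity), Real.sqrt_sq hε.le]
    _ ≤ (Real.sqrt K₂ + 1) / ε := by
      gcongr
      linarith
end
end

section
/- (Uniform closeness to a well on circles) There exists a constant C_unf > 0 depending only on V such that for all ε, r with 0 < ε ≤ 1 and ε < r ≤ 1 and every smooth map u : S¹(r) → ℝ^k on the circle S¹(r) of radius r, there exists σ ∈ Σ with, for all ℓ ∈ S¹(r): |u(ℓ) − σ| ≤ C_unf·√( ∫_{S¹(r)} (1/2)·( J(u) + r⁻¹·V(u) ) dℓ ), where J(u)(ℓ) = |u'(ℓ)|·√(V(u(ℓ))) with u' the derivative of u along the circle; consequently |u(ℓ) − σ| ≤ C_unf·√( ∫_{S¹(r)} e_ε(u) dℓ ) for all ℓ ∈ S¹(r). -/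
open MeasureTheory Metric Filter Topology Bornology
open scoped RealInnerProductSpace ENNReal Topology

noncomputable section

/-- If the radial derivative of a nonnegative function from `p` grows at least linearly on the
outer half of the segment `[p, p + w]`, then the function grows quadratically. -/
theorem quadratic_lower_bound_of_radial_fderiv {E : Type*} [NormedAddCommGroup E]
    [NormedSpace ℝ E] {V : E → ℝ} (hd : Differentiable ℝ V) (h0 : ∀ y, 0 ≤ V y) {p w : E} {α : ℝ}
    (hα : 0 ≤ α)
    (h : ∀ t ∈ Set.Ioo (1 / 2 : ℝ) 1, α * t * ‖w‖ ^ 2 ≤ fderiv ℝ V (p + t • w) w) :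
    α / 4 * ‖w‖ ^ 2 ≤ V (p + w) := by
  have hder : ∀ t : ℝ, HasDerivAt (fun s : ℝ => V (p + s • w)) (fderiv ℝ V (p + t • w) w) t := by
    intro t
    have hline : HasDerivAt (fun s : ℝ => p + s • w) w t := by
      simpa using ((hasDerivAt_id t).smul_const w).const_add p
    exact (hd (p + t • w)).hasFDerivAt.comp_hasDerivAt t hline
  obtain ⟨t, ht, hslope⟩ := exists_hasDerivAt_eq_slope (fun s : ℝ => V (p + s • w))
    (fun t => fderiv ℝ V (p + t • w) w) (by norm_num : (1 / 2 : ℝ) < 1)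
    (fun s _ => (hder s).continuousAt.continuousWithinAt) (fun s _ => hder s)
  have hbound := h t ht
  rw [hslope] at hbound
  have hhalf := h0 (p + (1 / 2 : ℝ) • w)
  have hw : α * (1 / 2) * ‖w‖ ^ 2 ≤ α * t * ‖w‖ ^ 2 := by
    have := ht.1.le
    gcongr
  simp only [one_smul] at hbound
  norm_num at hbound hhalf hw ⊢
  linarith

/-- A nonnegative function vanishing at a point with positive definite Hessian there
grows quadratically near that point. -/
theorem eventually_quadratic_lower_bound_of_hessian_pos {E : Type*} [NormedAddCommGroup E]
    [NormedSpace ℝ E] [FiniteDimensional ℝ E] {V : E → ℝ} (hs : ContDiff ℝ 2 V)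
    (h0 : ∀ y, 0 ≤ V y) {σ : E} (hσ : V σ = 0)
    (hpos : ∀ w : E, w ≠ 0 → 0 < iteratedFDeriv ℝ 2 V σ ![w, w]) :
    ∃ c > (0 : ℝ), ∀ᶠ y in 𝓝 σ, c * ‖y - σ‖ ^ 2 ≤ V y := by
  have hpos' : ∀ w : E, w ≠ 0 → 0 < fderiv ℝ (fderiv ℝ V) σ w w := by
    intro w hw
    simpa [iteratedFDeriv_two_apply] using hpos w hw
  have hd : Differentiable ℝ V := hs.differentiable (by norm_num)
  have hd2 : Differentiable ℝ (fderiv ℝ V) :=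
    (hs.fderiv_right (m := 1) (by norm_num)).differentiable (by norm_num)
  have hcrit : fderiv ℝ V σ = 0 :=
    IsLocalMin.fderiv_eq_zero (Eventually.of_forall fun y => hσ ▸ h0 y)
  have : ProperSpace E := FiniteDimensional.proper ℝ E
  obtain ⟨m, hm, hmle⟩ := (isCompact_sphere (0 : E) 1).exists_forall_le'
    (f := fun w => fderiv ℝ (fderiv ℝ V) σ w w) (a := 0) (by fun_prop)
    (fun w hw => hpos' w (ne_zero_of_mem_unit_sphere ⟨w, hw⟩))
  have hcoer : ∀ w : E, m * ‖w‖ ^ 2 ≤ fderiv ℝ (fderiv ℝ V) σ w w := by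
    intro w
    rcases eq_or_ne w 0 with rfl | hw
    · simp
    have hn : ‖w‖ ≠ 0 := norm_ne_zero_iff.2 hw
    have hunit := hmle (‖w‖⁻¹ • w) (by simp [norm_smul, hn])
    simp only [map_smul, smul_apply, smul_eq_mul] at hunit
    calc m * ‖w‖ ^ 2
        ≤ (‖w‖⁻¹ * (‖w‖⁻¹ * fderiv ℝ (fderiv ℝ V) σ w w)) * ‖w‖ ^ 2 := by gcongr
      _ = fderiv ℝ (fderiv ℝ V) σ w w := by field_simp
  have hlin := (hd2 σ).hasFDerivAt.isLittleO.def (half_pos hm)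
  obtain ⟨ρ, hρ, hball⟩ := Metric.eventually_nhds_iff_ball.1 hlin
  refine ⟨m / 2 / 4, by positivity, Metric.eventually_nhds_iff_ball.2 ⟨ρ, hρ, fun y hy => ?_⟩⟩
  have key := quadratic_lower_bound_of_radial_fderiv hd h0 (p := σ) (w := y - σ)
    (half_pos hm).le (fun t ht => ?_)
  · simpa using key
  have ht0 : 0 < t := by linarith [ht.1]
  set w := y - σ with hw
  have hmem : σ + t • w ∈ ball σ ρ := by
    rw [mem_ball, dist_eq_norm, ← hw] at hy
    rw [mem_ball, dist_eq_norm, add_sub_cancel_left, norm_smul, Real.norm_of_nonneg ht0.le]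
    nlinarith [norm_nonneg w, ht.2]
  have hrem := hball _ hmem
  rw [hcrit, sub_zero, add_sub_cancel_left, norm_smul, Real.norm_of_nonneg ht0.le] at hrem
  have happ := (ContinuousLinearMap.le_opNorm
    (fderiv ℝ V (σ + t • w) - fderiv ℝ (fderiv ℝ V) σ (t • w)) w).trans
    (mul_le_mul_of_nonneg_right hrem (norm_nonneg w))
  rw [Real.norm_eq_abs] at happ
  have hneg := (abs_le.1 happ).1
  simp only [map_smul, sub_apply, smul_apply, smul_eq_mul] at hneg
  have hmul := mul_le_mul_of_nonneg_left (hcoer w) ht0.le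
  nlinarith

theorem IsMultiWell.nontrivial_zeros {k : ℕ} {V : Evec k → ℝ} (hV : IsMultiWell V) :
    {y | V y = 0}.Nontrivial :=
  (Set.one_lt_ncard_iff_nontrivial_and_finite.1 hV.two_le_card).1

/-- A multi-well potential controls the squared distance to its set of wells. -/
theorem IsMultiWell.exists_mul_infDist_sq_le {k : ℕ} {V : Evec k → ℝ} (hV : IsMultiWell V) :
    ∃ c > (0 : ℝ), ∀ y, c * infDist y {y | V y = 0} ^ 2 ≤ V y := by
  set S : Set (Evec k) := {y | V y = 0} with hS
  have hd : Differentiable ℝ V := hV.smooth.differentiable (by simp)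
  have hcont : Continuous V := hd.continuous
  obtain ⟨α, hα, R, hR, hgrow⟩ := hV.growth
  obtain ⟨σ₀, hσ₀⟩ : S.Nonempty := hV.nontrivial_zeros.nonempty
  have hloc : ∃ c > (0 : ℝ), ∀ y ∈ closedBall (0 : Evec k) (2 * R + ‖σ₀‖ + 1),
      c * infDist y S ^ 2 ≤ V y := by
    refine (isCompact_closedBall (0 : Evec k) (2 * R + ‖σ₀‖ + 1)).induction_on
      (p := fun s => ∃ c > (0 : ℝ), ∀ y ∈ s, c * infDist y S ^ 2 ≤ V y) ?_ ?_ ?_ ?_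
    · exact ⟨1, one_pos, by simp⟩
    · rintro s t hst ⟨c, hc, h⟩
      exact ⟨c, hc, fun y hy => h y (hst hy)⟩
    · rintro s t ⟨c, hc, h⟩ ⟨c', hc', h'⟩
      refine ⟨min c c', lt_min hc hc', ?_⟩
      rintro y (hy | hy)
      · exact le_trans (by gcongr; exact min_le_left _ _) (h y hy)
      · exact le_trans (by gcongr; exact min_le_right _ _) (h' y hy)
    · intro x _
      suffices ∃ c > (0 : ℝ), ∀ᶠ y in 𝓝 x, c * infDist y S ^ 2 ≤ V y by
        obtain ⟨c, hc, h⟩ := this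
        exact ⟨_, mem_nhdsWithin_of_mem_nhds h, c, hc, fun y hy => hy⟩
      by_cases hx : V x = 0
      · obtain ⟨c, hc, h⟩ := eventually_quadratic_lower_bound_of_hessian_pos
          (contDiff_infty.1 hV.smooth 2) hV.nonneg hx (hV.hess_posdef x hx)
        refine ⟨c, hc, h.mono fun y hy => le_trans ?_ hy⟩
        have : infDist y S ≤ ‖y - x‖ := by
          rw [← dist_eq_norm]; exact infDist_le_dist_of_mem hx
        have := infDist_nonneg (x := y) (s := S)
        gcongr
      · have hpos : 0 < V x := lt_of_le_of_ne (hV.nonneg x) (Ne.symm hx)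
        have hinf : 0 < infDist x S ^ 2 + 1 := by positivity
        refine ⟨V x / 2 / (infDist x S ^ 2 + 1), by positivity, ?_⟩
        have hlt : V x / 2 / (infDist x S ^ 2 + 1) * infDist x S ^ 2 < V x := by
          rw [div_mul_eq_mul_div, div_lt_iff₀ hinf]
          nlinarith [sq_nonneg (infDist x S)]
        exact (ContinuousAt.eventually_lt (by fun_prop) hcont.continuousAt hlt).mono
          fun y hy => hy.le
  obtain ⟨c, hc, hcle⟩ := hloc
  refine ⟨min c (α / 16), lt_min hc (by positivity), fun y => ?_⟩
  by_cases hy : y ∈ closedBall (0 : Evec k) (2 * R + ‖σ₀‖ + 1)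
  · exact le_trans (by gcongr; exact min_le_left _ _) (hcle y hy)
  rw [mem_closedBall_zero_iff, not_le] at hy
  have hfar : α / 4 * ‖y‖ ^ 2 ≤ V y := by
    have := quadratic_lower_bound_of_radial_fderiv hd hV.nonneg (p := 0) (w := y) hα.le
      (fun t ht => ?_)
    · simpa using this
    have ht0 : 0 < t := by linarith [ht.1]
    have hnorm : ‖t • y‖ = t * ‖y‖ := by rw [norm_smul, Real.norm_of_nonneg ht0.le]
    have hlarge : R < ‖t • y‖ := by
      rw [hnorm]
      nlinarith [ht.1, norm_nonneg σ₀, norm_nonneg y]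
    have hg := hgrow _ hlarge
    rw [hnorm, real_inner_comm, gradient, InnerProductSpace.toDual_symm_apply, map_smul,
      smul_eq_mul] at hg
    rw [zero_add]
    refine le_of_mul_le_mul_left ?_ ht0
    linarith
  have hdist : infDist y S ≤ 2 * ‖y‖ := by
    calc infDist y S ≤ dist y σ₀ := infDist_le_dist_of_mem hσ₀
      _ ≤ ‖y‖ + ‖σ₀‖ := dist_le_norm_add_norm _ _
      _ ≤ 2 * ‖y‖ := by linarith
  have := infDist_nonneg (x := y) (s := S)
  calc min c (α / 16) * infDist y S ^ 2 ≤ α / 16 * (2 * ‖y‖) ^ 2 := by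
        gcongr; exact min_le_right _ _
    _ = α / 4 * ‖y‖ ^ 2 := by ring
    _ ≤ V y := hfar

/-- The squared distance to a compact set along a curve grows at most as fast as the integral of
any continuous function bounding twice the distance times the speed. -/
theorem infDist_sq_le_add_integral {E : Type*} [NormedAddCommGroup E] [InnerProductSpace ℝ E]
    {S : Set E} (hS : IsCompact S) (hne : S.Nonempty) {g : ℝ → E} (hg : Differentiable ℝ g)
    {φ : ℝ → ℝ} (hφ : Continuous φ)
    (hle : ∀ t, 2 * infDist (g t) S * ‖deriv g t‖ ≤ φ t) {a t : ℝ} (hat : a ≤ t) :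
    infDist (g t) S ^ 2 ≤ infDist (g a) S ^ 2 + ∫ s in a..t, φ s := by
  have hgc : Continuous g := hg.continuous
  have hB : ∀ x, HasDerivAt (fun x => infDist (g a) S ^ 2 + ∫ s in a..x, φ s) (φ x) x :=
    fun x => (hφ.integral_hasStrictDerivAt a x).hasDerivAt.const_add _
  refine image_le_of_liminf_slope_right_le_deriv_boundary
    (f := fun x => infDist (g x) S ^ 2) (a := a) (b := t)
    (B := fun x => infDist (g a) S ^ 2 + ∫ s in a..x, φ s) (B' := φ)
    (by fun_prop) (by simp) (fun x _ => (hB x).continuousAt.continuousWithinAt)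
    (fun x _ => (hB x).hasDerivWithinAt) (fun x _ r hr => ?_) (Set.right_mem_Icc.2 hat)
  obtain ⟨σ, hσ, hσd⟩ := hS.exists_infDist_eq_dist hne (g x)
  have hder := ((hg x).hasDerivAt.sub_const σ).norm_sq
  have hlt : 2 * ⟪g x - σ, deriv g x⟫ < r := by
    refine lt_of_le_of_lt ?_ hr
    refine le_trans ?_ (hle x)
    rw [hσd, dist_eq_norm]
    linarith [real_inner_le_norm (g x - σ) (deriv g x)]
  have hev := ((hasDerivWithinAt_iff_tendsto_slope' (by simp)).1
    (hder.hasDerivWithinAt (s := Set.Ioi x))).eventually_lt_const hlt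
  refine (hev.and self_mem_nhdsWithin).frequently.mono fun z hz => lt_of_le_of_lt ?_ hz.1
  have hxz : 0 < z - x := sub_pos.2 hz.2
  have hz' : infDist (g z) S ≤ ‖g z - σ‖ := by
    rw [← dist_eq_norm]; exact infDist_le_dist_of_mem hσ
  have := infDist_nonneg (x := g z) (s := S)
  simp only [slope_def_field]
  rw [← dist_eq_norm (g x), ← hσd]
  gcongr

/-- A curve staying uniformly close to a finite set stays close to a single one of its points,
with a constant depending only on the finite set. -/
theorem exists_forall_norm_sub_le_of_infDist_le {E : Type*} [NormedAddCommGroup E]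
    {S : Set E} (hS : S.Finite) (hne : S.Nontrivial) :
    ∃ C > (0 : ℝ), ∀ (g : ℝ → E) (η : ℝ), Continuous g → (∀ t, infDist (g t) S ≤ η) →
      ∃ σ ∈ S, ∀ t, ‖g t - σ‖ ≤ C * η := by
  have hδ : 0 < S.infsep / 2 := half_pos ((hS.infsep_pos_iff_nontrivial).2 hne)
  set δ := S.infsep / 2 with hδ_def
  have hsep : ∀ σ ∈ S, ∀ τ ∈ S, σ ≠ τ → 2 * δ ≤ dist σ τ := fun σ hσ τ hτ hστ => by
    have := Set.infsep_le_dist_of_mem hσ hτ hστ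
    linarith
  have hdiam : 0 ≤ diam S := diam_nonneg
  have hC : 0 ≤ diam S / δ := by positivity
  refine ⟨1 + diam S / δ, by positivity, fun g η hg hη => ?_⟩
  have hη0 : 0 ≤ η := infDist_nonneg.trans (hη 0)
  have hnear : ∀ t, ∃ σ ∈ S, dist (g t) σ ≤ η := fun t => by
    obtain ⟨σ, hσ, h⟩ := hS.isCompact.exists_infDist_eq_dist hne.nonempty (g t)
    exact ⟨σ, hσ, h ▸ hη t⟩
  obtain ⟨σ, hσ, hσ0⟩ := hnear 0
  refine ⟨σ, hσ, fun t => ?_⟩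
  rw [← dist_eq_norm]
  obtain ⟨τ, hτ, hτt⟩ := hnear t
  rcases lt_or_ge η δ with hlt | hge
  · have hstay : dist (g t) σ < δ := by
      by_contra! hcon
      obtain ⟨s, hs⟩ := mem_range_of_exists_le_of_exists_ge (c := δ)
        (f := fun s => dist (g s) σ) (by fun_prop) ⟨0, (hσ0.trans_lt hlt).le⟩ ⟨t, hcon⟩
      obtain ⟨υ, hυ, hυs⟩ := hnear s
      simp only at hs
      have hne' : σ ≠ υ := by
        rintro rfl
        linarith
      linarith [hsep σ hσ υ hυ hne', dist_triangle_left σ υ (g s)]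
    have heq : σ = τ := by
      by_contra hne'
      linarith [hsep σ hσ τ hτ hne', dist_triangle_left σ τ (g t)]
    rw [heq]
    nlinarith
  · have h1 := dist_triangle (g t) τ σ
    have h2 := dist_le_diam_of_mem hS.isBounded hτ hσ
    have h3 : diam S ≤ diam S / δ * η := by
      calc diam S = diam S / δ * δ := by field_simp
        _ ≤ diam S / δ * η := by gcongr
    linarith

/-- The distance to the wells along a periodic curve is controlled by the square root of the
Modica–Mortola type energy. -/
theorem IsMultiWell.exists_infDist_le_sqrt_integral {k : ℕ} {V : Evec k → ℝ}
    (hV : IsMultiWell V) :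
    ∃ C > (0 : ℝ), ∀ g : ℝ → Evec k, ContDiff ℝ 1 g → Function.Periodic g (2 * Real.pi) →
      ∀ t, infDist (g t) {y | V y = 0} ≤
        C * √(∫ s in (0 : ℝ)..(2 * Real.pi), 1 / 2 * (‖deriv g s‖ * √(V (g s)) + V (g s))) := by
  obtain ⟨c, hc, hcle⟩ := hV.exists_mul_infDist_sq_le
  set S : Set (Evec k) := {y | V y = 0} with hS
  have hne : S.Nonempty := hV.nontrivial_zeros.nonempty
  have hVc : Continuous V := hV.smooth.continuous
  refine ⟨√(1 / c + 4 / √c), by positivity, fun g hg hper t => ?_⟩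
  have hgc : Continuous g := hg.continuous
  have hg'c : Continuous (deriv g) := hg.continuous_deriv le_rfl
  have hpi := Real.pi_pos
  set X := ∫ s in (0 : ℝ)..(2 * Real.pi), 1 / 2 * (‖deriv g s‖ * √(V (g s)) + V (g s)) with hX
  have hsplit : 2 * X = (∫ s in (0 : ℝ)..(2 * Real.pi), ‖deriv g s‖ * √(V (g s))) +
      ∫ s in (0 : ℝ)..(2 * Real.pi), V (g s) := by
    rw [hX, intervalIntegral.integral_const_mul, intervalIntegral.integral_add
      (Continuous.intervalIntegrable (by fun_prop) _ _)
      (Continuous.intervalIntegrable (by fun_prop) _ _)]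
    ring
  have hJ0 : 0 ≤ ∫ s in (0 : ℝ)..(2 * Real.pi), ‖deriv g s‖ * √(V (g s)) :=
    intervalIntegral.integral_nonneg (by positivity) fun s _ => by positivity
  have hV0 : 0 ≤ ∫ s in (0 : ℝ)..(2 * Real.pi), V (g s) :=
    intervalIntegral.integral_nonneg (by positivity) fun s _ => hV.nonneg _
  obtain ⟨a, -, hmin⟩ := isCompact_Icc.exists_isMinOn
    (Set.nonempty_Icc.2 (by positivity : (0 : ℝ) ≤ 2 * Real.pi))
    (f := fun s => V (g s)) (by fun_prop)
  have hVa : V (g a) ≤ X := by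
    have hmono := intervalIntegral.integral_mono_on (μ := volume)
      (by positivity : (0 : ℝ) ≤ 2 * Real.pi) (f := fun _ => V (g a)) (g := fun s => V (g s))
      (by simp) (Continuous.intervalIntegrable (by fun_prop) _ _) (fun s hs => hmin hs)
    rw [intervalIntegral.integral_const, smul_eq_mul, sub_zero] at hmono
    nlinarith [Real.pi_gt_three, hV.nonneg (g a)]
  obtain ⟨b, ⟨hab, hb⟩, hbt⟩ := hper.exists_mem_Ico (by positivity) t a
  have hsqrt : ∀ s, √c * infDist (g s) S ≤ √(V (g s)) := fun s => by
    refine Real.le_sqrt_of_sq_le ?_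
    rw [mul_pow, Real.sq_sqrt hc.le]
    exact hcle _
  have hφ : Continuous fun s => 2 / √c * (‖deriv g s‖ * √(V (g s))) := by fun_prop
  have hgrowth := infDist_sq_le_add_integral hV.finite_zeros.isCompact hne
    (hg.differentiable one_ne_zero) hφ (fun s => by
      have := mul_le_mul_of_nonneg_right (hsqrt s) (norm_nonneg (deriv g s))
      rw [div_mul_eq_mul_div, le_div_iff₀ (by positivity)]
      linarith) hab
  have hperJ : Function.Periodic (fun s => 2 / √c * (‖deriv g s‖ * √(V (g s))))
      (2 * Real.pi) := fun s => by
    have : deriv g (s + 2 * Real.pi) = deriv g s := by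
      rw [← deriv_comp_add_const]
      congr 1
      exact funext hper
    simp only [hper s, this]
  have hint : ∫ s in a..b, 2 / √c * (‖deriv g s‖ * √(V (g s))) ≤ 4 / √c * X := by
    calc ∫ s in a..b, 2 / √c * (‖deriv g s‖ * √(V (g s)))
        ≤ ∫ s in a..(a + 2 * Real.pi), 2 / √c * (‖deriv g s‖ * √(V (g s))) :=
          intervalIntegral.integral_mono_interval le_rfl hab hb.le
            (Eventually.of_forall fun s => by positivity) (hφ.intervalIntegrable _ _)
      _ = 2 / √c * ∫ s in (0 : ℝ)..(2 * Real.pi), ‖deriv g s‖ * √(V (g s)) := by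
          rw [hperJ.intervalIntegral_add_eq a 0, zero_add, intervalIntegral.integral_const_mul]
      _ ≤ 2 / √c * (2 * X) := by gcongr; linarith
      _ = 4 / √c * X := by ring
  have hda : infDist (g a) S ^ 2 ≤ 1 / c * X := by
    rw [div_mul_eq_mul_div, one_mul, le_div_iff₀ hc]
    linarith [hcle (g a)]
  rw [hbt, ← Real.sqrt_mul (by positivity)]
  refine Real.le_sqrt_of_sq_le ?_
  linarith

/-- uniform closeness to a well on circles. There is
`C_unf > 0` depending only on `V` such that for all `0 < ε ≤ 1`, `ε < r ≤ 1`
and every smooth map on the circle `S¹(r)` — parametrized as `g(θ) = u(r e^{iθ})`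
with `g : ℝ → ℝ^k` smooth and `2π`-periodic, so that the arclength derivative is
`|u'| = |g'|/r` and `∫_{S¹(r)} F dℓ = ∫₀^{2π} F·r dθ` — there is a well
`σ ∈ Σ` with `|u(ℓ) − σ| ≤ C_unf·√(∫_{S¹(r)} ½(J(u) + r⁻¹V(u)) dℓ)` for all
`ℓ ∈ S¹(r)`, where `J(u) = |u'|·√(V(u))`; consequently
`|u(ℓ) − σ| ≤ C_unf·√(∫_{S¹(r)} e_ε(u) dℓ)` for all `ℓ ∈ S¹(r)`. -/
theorem statement_17 (k : ℕ) (hk : 1 ≤ k) (V : Evec k → ℝ) (hV : IsMultiWell V) :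
    ∃ Cunf > (0 : ℝ),
      ∀ ε r : ℝ, 0 < ε → ε ≤ 1 → ε < r → r ≤ 1 →
      ∀ g : ℝ → Evec k, ContDiff ℝ (⊤ : ℕ∞) g →
        (∀ θ : ℝ, g (θ + 2 * Real.pi) = g θ) →
        ∃ σ : Evec k, V σ = 0 ∧
          (∀ θ : ℝ, ‖g θ - σ‖ ≤
            Cunf * Real.sqrt (∫ t in (0 : ℝ)..(2 * Real.pi),
              (1 / 2 * ((‖deriv g t‖ / r) * Real.sqrt (V (g t)) +
                r⁻¹ * V (g t))) * r)) ∧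
          (∀ θ : ℝ, ‖g θ - σ‖ ≤
            Cunf * Real.sqrt (∫ t in (0 : ℝ)..(2 * Real.pi),
              (ε / 2 * (‖deriv g t‖ / r) ^ 2 + ε⁻¹ * V (g t)) * r)) := by
  obtain ⟨C₁, hC₁, hclose⟩ := hV.exists_infDist_le_sqrt_integral
  obtain ⟨C₂, hC₂, hwell⟩ := exists_forall_norm_sub_le_of_infDist_le hV.finite_zeros
    hV.nontrivial_zeros
  refine ⟨C₂ * C₁, by positivity, fun ε r hε _ hεr _ g hg hper => ?_⟩
  have hr : 0 < r := hε.trans hεr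
  have hg1 : ContDiff ℝ 1 g := hg.of_le (by exact_mod_cast le_top)
  have hgc : Continuous g := hg1.continuous
  have hg'c : Continuous (deriv g) := hg1.continuous_deriv le_rfl
  have hVc : Continuous V := hV.smooth.continuous
  obtain ⟨σ, hσ, hσle⟩ := hwell g _ hgc (hclose g hg1 hper)
  have hcancel : ∀ t, 1 / 2 * (‖deriv g t‖ / r * √(V (g t)) + r⁻¹ * V (g t)) * r =
      1 / 2 * (‖deriv g t‖ * √(V (g t)) + V (g t)) := fun t => by field_simp
  have hfirst : ∀ θ, ‖g θ - σ‖ ≤ C₂ * C₁ * √(∫ t in (0 : ℝ)..(2 * Real.pi),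
      1 / 2 * (‖deriv g t‖ / r * √(V (g t)) + r⁻¹ * V (g t)) * r) := fun θ => by
    simp only [hcancel, mul_assoc C₂]
    exact hσle θ
  refine ⟨σ, hσ, hfirst, fun θ => (hfirst θ).trans ?_⟩
  have hpi := Real.pi_pos
  gcongr
  refine intervalIntegral.integral_mono_on (by positivity)
    (Continuous.intervalIntegrable (by fun_prop) _ _)
    (Continuous.intervalIntegrable (by fun_prop) _ _) fun t _ => ?_
  gcongr ?_ * r
  set d := ‖deriv g t‖ / r with hd
  have hd0 : 0 ≤ d := by positivity
  obtain ⟨v, hv0, hv⟩ : ∃ v, 0 ≤ v ∧ v ^ 2 = V (g t) :=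
    ⟨_, Real.sqrt_nonneg _, Real.sq_sqrt (hV.nonneg _)⟩
  rw [← hv, Real.sqrt_sq hv0]
  have hinv : r⁻¹ * v ^ 2 ≤ ε⁻¹ * v ^ 2 := by gcongr
  have hyoung : d * v ≤ ε / 2 * d ^ 2 + ε⁻¹ / 2 * v ^ 2 := by
    have : ε / 2 * d ^ 2 + ε⁻¹ / 2 * v ^ 2 - d * v = ε⁻¹ / 2 * (ε * d - v) ^ 2 := by
      field_simp
      ring
    have : 0 ≤ ε⁻¹ / 2 * (ε * d - v) ^ 2 := by positivity
    linarith
  have : 0 ≤ d * v := by positivity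
  linarith
end
end
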